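/- arXiv:1205.0654 — 6 statements merged into one kernel-verified Lean document; each statement's English description precedes it below -/
import Mathlib

section
/- Let B be a real symmetric N×N matrix and Δt > 0 such that every eigenvalue λ of B satisfies 0 < (Δt²/4) λ < 1. Then every sequence (z_n) in ℝ^N satisfying z_{n+1} = 2 z_n − z_{n−1} − Δt² B z_n for all n ≥ 1 is bounded: sup_n ‖z_n‖ < ∞. -/
open Matrix

/-- Scalar leap-frog recurrences with `|c| < 1` are bounded, by conservation of a quadratic form. -/
theorem scalar_bounded (c : ℝ) (h1 : -1 < c) (h2 : c < 1) (y : ℕ → ℝ)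
    (h : ∀ n, y (n + 2) = 2 * c * y (n + 1) - y n) : ∃ C : ℝ, ∀ n, (y n) ^ 2 ≤ C := by
  have hE : ∀ n, y (n + 1) ^ 2 + y n ^ 2 - 2 * c * y (n + 1) * y n
      = y 1 ^ 2 + y 0 ^ 2 - 2 * c * y 1 * y 0 := by
    intro n
    induction n with
    | zero => simp
    | succ k ih => rw [← ih, h k]; ring
  have hc : 0 < 1 - c ^ 2 := by nlinarith
  refine ⟨(y 1 ^ 2 + y 0 ^ 2 - 2 * c * y 1 * y 0) / (1 - c ^ 2), fun n => ?_⟩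
  rw [le_div_iff₀ hc, ← hE n]
  nlinarith [sq_nonneg (y (n + 1) - c * y n)]

/-- if `B` is symmetric and every eigenvalue `λ` of `B` satisfies
`0 < (Δt²/4) λ < 1`, then every sequence satisfying the leap-frog recurrence
`z_{n+1} = 2 z_n − z_{n−1} − Δt² B z_n` is bounded in the Euclidean norm. -/
theorem stmt_6 (N : ℕ) (B : Matrix (Fin N) (Fin N) ℝ) (hB : B.IsSymm)
    (Δt : ℝ) (hΔt : 0 < Δt)
    (heig : ∀ (μ : ℝ) (v : Fin N → ℝ), v ≠ 0 → B.mulVec v = μ • v →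
      0 < Δt ^ 2 / 4 * μ ∧ Δt ^ 2 / 4 * μ < 1)
    (z : ℕ → (Fin N → ℝ))
    (hrec : ∀ n : ℕ, 1 ≤ n →
      z (n + 1) = (2 : ℝ) • z n - z (n - 1) - Δt ^ 2 • B.mulVec (z n)) :
    ∃ C : ℝ, ∀ n : ℕ, Real.sqrt (∑ i, (z n i) ^ 2) ≤ C := by
  have hH : B.IsHermitian := by
    rw [Matrix.IsHermitian, Matrix.conjTranspose_eq_transpose_of_trivial]; exact hB
  have key : ∀ j, ∃ C : ℝ, ∀ n, ((hH.eigenvectorBasis j).ofLp ⬝ᵥ z n) ^ 2 ≤ C := by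
    intro j
    have hv := hH.mulVec_eigenvectorBasis j
    have hne : (hH.eigenvectorBasis j).ofLp ≠ 0 := by
      intro h0
      have := hH.eigenvectorBasis.orthonormal.ne_zero j
      exact this (by ext i; simpa using congrFun h0 i)
    obtain ⟨ha, hb⟩ := heig _ _ hne hv
    refine scalar_bounded (1 - Δt ^ 2 * hH.eigenvalues j / 2) (by linarith) (by linarith) _ ?_
    intro n
    have hr := hrec (n + 1) (by omega)
    rw [show n + 1 + 1 = n + 2 from rfl, Nat.add_sub_cancel] at hr
    have hs : (hH.eigenvectorBasis j).ofLp ⬝ᵥ B *ᵥ z (n + 1)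
        = hH.eigenvalues j * ((hH.eigenvectorBasis j).ofLp ⬝ᵥ z (n + 1)) := by
      rw [Matrix.dotProduct_mulVec, ← Matrix.mulVec_transpose, hB.eq, hv, smul_dotProduct,
        smul_eq_mul]
    rw [hr, dotProduct_sub, dotProduct_sub, dotProduct_smul, dotProduct_smul, hs]
    simp only [smul_eq_mul]
    ring
  choose C hC using key
  refine ⟨Real.sqrt (∑ j, C j), fun n => Real.sqrt_le_sqrt ?_⟩
  have hp := hH.eigenvectorBasis.sum_sq_norm_inner_right (WithLp.toLp 2 (z n))
  rw [EuclideanSpace.norm_sq_eq] at hp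
  simp only [Real.norm_eq_abs, sq_abs] at hp
  rw [← hp]
  refine Finset.sum_le_sum fun j _ => ?_
  refine le_trans (le_of_eq ?_) (hC j n)
  rw [EuclideanSpace.inner_eq_star_dotProduct, dotProduct_comm]
  simp
end

section
/- Let A, P be real N×N matrices, let F : ℝ → ℝ^N be continuous, and let z̃₁, z̃₂ : ℝ → ℝ^N be twice differentiable solutions of z̃''(τ) = F(τ) − A P z̃(τ) with the same initial value z̃₁(0) = z̃₂(0) but possibly different initial derivatives z̃₁'(0) ≠ z̃₂'(0). Then z̃₁(τ) + z̃₁(−τ) = z̃₂(τ) + z̃₂(−τ) for all τ ∈ ℝ. In particular, the quantity z̃(Δt) + z̃(−Δt) appearing in the LTS-LF2 construction does not depend on the choice of the initial derivative ν = z̃'(0). -/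
open Matrix

/-- two solutions of `z̃'' = F(τ) − A P z̃` with the same initial value (but
possibly different initial derivatives) have the same symmetric part:
`z̃₁(τ) + z̃₁(−τ) = z̃₂(τ) + z̃₂(−τ)` for all `τ`. -/
theorem stmt_9 (N : ℕ) (A P : Matrix (Fin N) (Fin N) ℝ) (F : ℝ → (Fin N → ℝ))
    (hF : Continuous F) (zt₁ zt₂ : ℝ → (Fin N → ℝ))
    (h₁d : Differentiable ℝ zt₁) (h₁d' : Differentiable ℝ (deriv zt₁))
    (h₂d : Differentiable ℝ zt₂) (h₂d' : Differentiable ℝ (deriv zt₂))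
    (hode₁ : ∀ τ : ℝ, deriv (deriv zt₁) τ = F τ - (A * P).mulVec (zt₁ τ))
    (hode₂ : ∀ τ : ℝ, deriv (deriv zt₂) τ = F τ - (A * P).mulVec (zt₂ τ))
    (h0 : zt₁ 0 = zt₂ 0) :
    ∀ τ : ℝ, zt₁ τ + zt₁ (-τ) = zt₂ τ + zt₂ (-τ) := by
  have hz₁ : ∀ t, HasDerivAt zt₁ (deriv zt₁ t) t := fun t => (h₁d t).hasDerivAt
  have hz₂ : ∀ t, HasDerivAt zt₂ (deriv zt₂ t) t := fun t => (h₂d t).hasDerivAt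
  have hy₁ : ∀ t, HasDerivAt (deriv zt₁) (F t - (A * P).mulVec (zt₁ t)) t :=
    fun t => hode₁ t ▸ (h₁d' t).hasDerivAt
  have hy₂ : ∀ t, HasDerivAt (deriv zt₂) (F t - (A * P).mulVec (zt₂ t)) t :=
    fun t => hode₂ t ▸ (h₂d' t).hasDerivAt
  have hneg : ∀ (g : ℝ → (Fin N → ℝ)) (g' : Fin N → ℝ) (t : ℝ), HasDerivAt g g' (-t) →
      HasDerivAt (fun t => g (-t)) (-g') t := by
    intro g g' t h
    have h2 := h.scomp t (hasDerivAt_neg t)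
    rw [neg_one_smul] at h2
    exact h2
  let M : (Fin N → ℝ) →L[ℝ] (Fin N → ℝ) := LinearMap.toContinuousLinearMap (A * P).mulVecLin
  have hM : ∀ x, M x = (A * P).mulVec x := fun x => rfl
  let L : ((Fin N → ℝ) × (Fin N → ℝ)) →L[ℝ] ((Fin N → ℝ) × (Fin N → ℝ)) :=
    (ContinuousLinearMap.snd ℝ (Fin N → ℝ) (Fin N → ℝ)).prod
      (-(M.comp (ContinuousLinearMap.fst ℝ (Fin N → ℝ) (Fin N → ℝ))))
  let f : ℝ → (Fin N → ℝ) × (Fin N → ℝ) := fun t =>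
    ((zt₁ t + zt₁ (-t)) - (zt₂ t + zt₂ (-t)),
     (deriv zt₁ t - deriv zt₁ (-t)) - (deriv zt₂ t - deriv zt₂ (-t)))
  have hf : ∀ t, HasDerivAt f (L (f t)) t := by
    intro t
    have ha := ((hz₁ t).add (hneg _ _ t (hz₁ (-t)))).sub ((hz₂ t).add (hneg _ _ t (hz₂ (-t))))
    have hb := ((hy₁ t).sub (hneg _ _ t (hy₁ (-t)))).sub ((hy₂ t).sub (hneg _ _ t (hy₂ (-t))))
    have hab := ha.prodMk hb
    refine hab.congr_deriv ?_
    refine Prod.ext ?_ ?_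
    · change _ = (deriv zt₁ t - deriv zt₁ (-t)) - (deriv zt₂ t - deriv zt₂ (-t))
      dsimp only
      abel
    · change _ = -(M ((zt₁ t + zt₁ (-t)) - (zt₂ t + zt₂ (-t))))
      simp only [hM, Matrix.mulVec_sub, Matrix.mulVec_add]
      abel
  have key : f = fun _ => 0 := by
    refine ODE_solution_unique_univ (v := fun _ => L) (s := fun _ => Set.univ) (t₀ := 0)
      (K := ‖L‖₊) (fun _ => L.lipschitz.lipschitzOnWith) (fun t => ⟨hf t, trivial⟩)
      (fun t => ⟨?_, trivial⟩) ?_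
    · simpa using hasDerivAt_const t (0 : (Fin N → ℝ) × (Fin N → ℝ))
    · simp [f, h0]
  intro τ
  have := congrArg Prod.fst (congrFun key τ)
  exact sub_eq_zero.mp this
end

section
/- Let A be a real N×N matrix, P a diagonal N×N matrix with 0/1 diagonal entries, R : ℝ → ℝ^N twice continuously differentiable, and let z : ℝ → ℝ^N satisfy z''(s) + A z(s) = R(s) for all s. Fix t ∈ ℝ and let q : ℝ → ℝ^N be the solution of q''(τ) = 2[ (I − P) R(t) − A (I − P) z(t) ] + P( R(t + τ) + R(t − τ) ) − A P q(τ), q(0) = 2 z(t), q'(0) = 0. Then, as Δt → 0, z(t + Δt) + z(t − Δt) = q(Δt) + O(Δt⁴). -/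
open Matrix Topology Asymptotics

lemma aux_int {E : Type*} [NormedAddCommGroup E] [NormedSpace ℝ E] (f f' : ℝ → E) (n : ℕ)
    (hf : ∀ x, HasDerivAt f (f' x) x) (h0 : f 0 = 0)
    (h : f' =O[𝓝 (0 : ℝ)] fun x => x ^ n) : f =O[𝓝 (0 : ℝ)] fun x => x ^ (n + 1) := by
  obtain ⟨C, hC⟩ := h.bound
  obtain ⟨ε, hε, hb⟩ := Metric.eventually_nhds_iff_ball.1 hC
  refine IsBigO.of_bound C ?_
  filter_upwards [Metric.ball_mem_nhds (0 : ℝ) hε] with x hx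
  have hx' : |x| < ε := by simpa using hx
  have hC0 : 0 ≤ C * |x| ^ n := by
    have := (norm_nonneg _).trans (hb x hx)
    simpa using this
  have key := (convex_closedBall (0 : ℝ) |x|).norm_image_sub_le_of_norm_hasDerivWithin_le
    (f := f) (f' := f') (C := C * |x| ^ n) (x := 0) (y := x)
    (fun y _ => (hf y).hasDerivWithinAt) (fun y hy => by
      have hy' : |y| ≤ |x| := by simpa using hy
      have h1 := hb y (by simpa using hy'.trans_lt hx')
      rw [norm_pow, Real.norm_eq_abs] at h1
      by_cases hc : 0 ≤ C
      · exact h1.trans (by gcongr)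
      · push Not at hc
        have h2 := (norm_nonneg _).trans h1
        have h3 : |y| ^ n = 0 := by
          have : 0 ≤ |y| ^ n := by positivity
          nlinarith
        rw [h3] at h1
        simp only [mul_zero] at h1
        exact h1.trans hC0) (by simp) (by simp)
  rw [h0, sub_zero, sub_zero, Real.norm_eq_abs] at key
  rw [norm_pow, Real.norm_eq_abs, pow_succ, ← mul_assoc]
  exact key

lemma aux_lin {E : Type*} [NormedAddCommGroup E] [NormedSpace ℝ E] (f : ℝ → E)
    (hf : DifferentiableAt ℝ f 0) (h0 : f 0 = 0) : f =O[𝓝 (0 : ℝ)] fun x => x ^ 1 := by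
  simpa [h0] using hf.isBigO_sub

lemma aux_c2 {E : Type*} [NormedAddCommGroup E] [NormedSpace ℝ E] (f : ℝ → E)
    (hf : ContDiff ℝ 2 f) : Differentiable ℝ f ∧ Differentiable ℝ (deriv f) := by
  have h2 : ContDiff ℝ (1 + 1) f := by simpa [one_add_one_eq_two] using hf
  exact ⟨hf.differentiable (by simp),
    (contDiff_succ_iff_deriv.1 h2).2.2.differentiable (by simp)⟩

lemma aux_plus {E : Type*} [NormedAddCommGroup E] [NormedSpace ℝ E] (f : ℝ → E)
    (hf : Differentiable ℝ f) (t x : ℝ) :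
    HasDerivAt (fun x => f (t + x)) (deriv f (t + x)) x :=
  (hf (t + x)).hasDerivAt.comp_const_add t x

lemma aux_minus {E : Type*} [NormedAddCommGroup E] [NormedSpace ℝ E] (f : ℝ → E)
    (hf : Differentiable ℝ f) (t x : ℝ) :
    HasDerivAt (fun x => f (t - x)) (- deriv f (t - x)) x :=
  (hf (t - x)).hasDerivAt.comp_const_sub t x

lemma aux_diff {E : Type*} [NormedAddCommGroup E] [NormedSpace ℝ E] (f : ℝ → E)
    (hf : ContDiff ℝ 2 f) (t : ℝ) :
    (fun x => f (t + x) + f (t - x) - (2 : ℝ) • f t) =O[𝓝 (0 : ℝ)] fun x => x ^ 2 := by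
  obtain ⟨h1, h2⟩ := aux_c2 f hf
  refine aux_int _ (fun x => deriv f (t + x) + - deriv f (t - x)) 1
    (fun x => ((aux_plus f h1 t x).add (aux_minus f h1 t x)).sub_const _)
    (by simp [two_smul]) (aux_lin _ ?_ (by simp))
  exact ((aux_plus _ h2 t 0).add (aux_minus _ h2 t 0).neg).differentiableAt

lemma aux_mul {N : ℕ} (M : Matrix (Fin N) (Fin N) ℝ) (f : ℝ → Fin N → ℝ) (g : ℝ → ℝ)
    (h : f =O[𝓝 (0 : ℝ)] g) : (fun x => M.mulVec (f x)) =O[𝓝 (0 : ℝ)] g :=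
  ((LinearMap.toContinuousLinearMap M.mulVecLin).isBigO_comp f _).trans h

/-- if `z'' + A z = R` and `q` solves
`q''(τ) = 2[(I−P)R(t) − A(I−P)z(t)] + P(R(t+τ) + R(t−τ)) − A P q(τ)`, `q(0) = 2z(t)`,
`q'(0) = 0`, then `z(t+Δt) + z(t−Δt) = q(Δt) + O(Δt⁴)` as `Δt → 0`. -/
theorem stmt_10 (N : ℕ) (A P : Matrix (Fin N) (Fin N) ℝ)
    (hPdiag : ∀ i j : Fin N, i ≠ j → P i j = 0)
    (hP01 : ∀ i : Fin N, P i i = 0 ∨ P i i = 1)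
    (R z : ℝ → (Fin N → ℝ)) (hR : ContDiff ℝ 2 R) (hz : ContDiff ℝ 2 z)
    (hode : ∀ s : ℝ, deriv (deriv z) s + A.mulVec (z s) = R s)
    (t : ℝ) (q : ℝ → (Fin N → ℝ)) (hq : ContDiff ℝ 2 q)
    (hqode : ∀ τ : ℝ, deriv (deriv q) τ
        = (2 : ℝ) • (((1 : Matrix (Fin N) (Fin N) ℝ) - P).mulVec (R t)
            - (A * ((1 : Matrix (Fin N) (Fin N) ℝ) - P)).mulVec (z t))
          + P.mulVec (R (t + τ) + R (t - τ)) - (A * P).mulVec (q τ))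
    (hq0 : q 0 = (2 : ℝ) • z t) (hq0' : deriv q 0 = 0) :
    (fun Δt : ℝ => z (t + Δt) + z (t - Δt) - q Δt) =O[𝓝 (0 : ℝ)] fun Δt => Δt ^ 4 := by
  obtain ⟨z1, z2⟩ := aux_c2 z hz
  obtain ⟨q1, q2⟩ := aux_c2 q hq
  have hqO : (fun x => q x - (2 : ℝ) • z t) =O[𝓝 (0 : ℝ)] fun x => x ^ 2 :=
    aux_int _ (deriv q) 1 (fun x => (q1 x).hasDerivAt.sub_const _) (by simp [hq0])
      (aux_lin _ (q2 0) hq0')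
  have hzO := aux_diff z hz t
  have hRO := aux_diff R hR t
  refine aux_int _ (fun x => deriv z (t + x) + - deriv z (t - x) - deriv q x) 3
    (fun x => ((aux_plus z z1 t x).add (aux_minus z z1 t x)).sub (q1 x).hasDerivAt)
    (by simp [hq0, two_smul]) ?_
  refine aux_int _ (fun x => deriv (deriv z) (t + x) + - - deriv (deriv z) (t - x)
      - deriv (deriv q) x) 2
    (fun x => ((aux_plus _ z2 t x).add (aux_minus _ z2 t x).neg).sub (q2 x).hasDerivAt)
    (by simp [hq0']) ?_
  have hz'' : ∀ s, deriv (deriv z) s = R s - A.mulVec (z s) := fun s => eq_sub_of_add_eq (hode s)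
  have H := ((aux_mul (1 - P) _ _ hRO).sub (aux_mul A _ _ hzO)).add (aux_mul (A * P) _ _ hqO)
  refine H.congr_left fun x => ?_
  rw [hz'', hz'', hqode]
  simp only [Matrix.mul_sub, Matrix.sub_mulVec, Matrix.mulVec_sub, Matrix.mulVec_add,
    Matrix.mulVec_smul, Matrix.one_mulVec, Matrix.mul_one, smul_sub]
  abel
end

section
/- Let A, D be real N×N matrices, R : ℝ → ℝ^N continuous, and let z : ℝ → ℝ^N be four times continuously differentiable with z''(s) + D z'(s) + A z(s) = R(s) for all s. Fix t ∈ ℝ. Then, as Δt → 0, z(t + Δt) − 2 z(t) + z(t − Δt) + (Δt/2) D ( z(t + Δt) − z(t − Δt) ) − Δt² ∫_{−1}^{1} (1 − |θ|) ( R(t + θ Δt) − A z(t + θ Δt) ) dθ = O(Δt⁴). -/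
open Matrix Topology Asymptotics intervalIntegral

section helpers

variable {E : Type*} [NormedAddCommGroup E] [NormedSpace ℝ E] [CompleteSpace E]

theorem aux_split (F G : ℝ → E) (hF : Continuous F) (K : ℝ → E) (hG : Continuous G)
    (hK : Continuous K) (h1 : ∀ x, 0 ≤ x → K x = F x) (h2 : ∀ x, x ≤ 0 → K x = G x) :
    ∫ θ in (-1 : ℝ)..1, K θ = (∫ θ in (-1 : ℝ)..0, G θ) + ∫ θ in (0 : ℝ)..1, F θ := by
  rw [← integral_add_adjacent_intervals (hK.intervalIntegrable (-1) 0)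
    (hK.intervalIntegrable 0 1)]
  congr 1
  · apply integral_congr
    intro x hx
    rw [Set.uIcc_of_le (by norm_num)] at hx
    exact h2 x hx.2
  · apply integral_congr
    intro x hx
    rw [Set.uIcc_of_le (by norm_num)] at hx
    exact h1 x hx.1

theorem aux_comp (z z1 : ℝ → E) (hz : ∀ s, HasDerivAt z (z1 s) s) (t h θ : ℝ) :
    HasDerivAt (fun θ : ℝ => z (t + θ * h)) (h • z1 (t + θ * h)) θ := by
  have h1 : HasDerivAt (fun θ : ℝ => t + θ * h) h θ := by
    simpa using ((hasDerivAt_id θ).mul_const h).const_add t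
  exact (hz (t + θ * h)).scomp θ h1

theorem aux_second (z z1 z2 : ℝ → E) (hz : ∀ s, HasDerivAt z (z1 s) s)
    (hz1 : ∀ s, HasDerivAt z1 (z2 s) s) (hc : Continuous z2) (t h : ℝ) :
    h ^ 2 • ∫ θ in (-1 : ℝ)..1, (1 - |θ|) • z2 (t + θ * h)
      = z (t + h) - (2 : ℝ) • z t + z (t - h) := by
  rw [← integral_smul]
  rw [aux_split (fun θ => h ^ 2 • (1 - θ) • z2 (t + θ * h))
    (fun θ => h ^ 2 • (1 + θ) • z2 (t + θ * h)) (by fun_prop) _ (by fun_prop) (by fun_prop)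
    (fun x hx => by simp only [abs_of_nonneg hx])
    (fun x hx => by simp only [abs_of_nonpos hx, sub_neg_eq_add])]
  have e1 := integral_eq_sub_of_hasDerivAt (a := (0:ℝ)) (b := 1)
    (f := fun θ => (1 - θ) • h • z1 (t + θ * h) + z (t + θ * h))
    (f' := fun θ => h ^ 2 • (1 - θ) • z2 (t + θ * h)) (fun θ _ => by
      have a := ((hasDerivAt_id θ).const_sub 1).smul
        ((aux_comp z1 z2 hz1 t h θ).const_smul h)
      refine (a.add (aux_comp z z1 hz t h θ)).congr_deriv ?_
      change (1 - θ) • h • h • z2 (t + θ * h) + (-1 : ℝ) • h • z1 (t + θ * h)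
        + h • z1 (t + θ * h) = _
      module)
    (Continuous.intervalIntegrable (by fun_prop) _ _)
  have e2 := integral_eq_sub_of_hasDerivAt (a := (-1:ℝ)) (b := 0)
    (f := fun θ => (1 + θ) • h • z1 (t + θ * h) - z (t + θ * h))
    (f' := fun θ => h ^ 2 • (1 + θ) • z2 (t + θ * h)) (fun θ _ => by
      have a := ((hasDerivAt_id θ).const_add 1).smul
        ((aux_comp z1 z2 hz1 t h θ).const_smul h)
      refine (a.sub (aux_comp z z1 hz t h θ)).congr_deriv ?_
      change (1 + θ) • h • h • z2 (t + θ * h) + (1 : ℝ) • h • z1 (t + θ * h)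
        - h • z1 (t + θ * h) = _
      module)
    (Continuous.intervalIntegrable (by fun_prop) _ _)
  rw [e1, e2]
  have : t + -1 * h = t - h := by ring
  simp only [this, one_mul, zero_mul, add_zero]
  module

theorem aux_first (z z1 : ℝ → E) (hz : ∀ s, HasDerivAt z (z1 s) s) (hc : Continuous z1)
    (t h : ℝ) : h • ∫ θ in (-1 : ℝ)..1, z1 (t + θ * h) = z (t + h) - z (t - h) := by
  rw [← integral_smul, integral_eq_sub_of_hasDerivAt (fun θ _ => aux_comp z z1 hz t h θ)
    (Continuous.intervalIntegrable (by fun_prop) _ _)]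
  have : t + -1 * h = t - h := by ring
  simp only [this, one_mul]

theorem aux_taylor (u u1 u2 : ℝ → E) (hu : ∀ s, HasDerivAt u (u1 s) s)
    (hu1 : ∀ s, HasDerivAt u1 (u2 s) s) (hc : Continuous u2) (t : ℝ) :
    ∃ C : ℝ, 0 ≤ C ∧ ∀ r, |r| ≤ 1 → ‖u (t + r) - u t - r • u1 t‖ ≤ C * r ^ 2 := by
  obtain ⟨C, hC⟩ := (isCompact_Icc (a := t - 1) (b := t + 1)).exists_bound_of_continuousOn
    hc.continuousOn
  have hC0 : 0 ≤ C := (norm_nonneg _).trans (hC t ⟨by linarith, by linarith⟩)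
  refine ⟨C, hC0, fun r hr => ?_⟩
  have hr' := abs_le.1 hr
  have hlip : ∀ s ∈ Set.Icc (t - 1) (t + 1), ‖u1 s - u1 t‖ ≤ C * |s - t| := by
    intro s hs
    exact (convex_Icc (t - 1) (t + 1)).norm_image_sub_le_of_norm_hasDerivWithin_le
      (fun x _ => (hu1 x).hasDerivWithinAt) hC ⟨by linarith, by linarith⟩ hs
  have key := (convex_uIcc t (t + r)).norm_image_sub_le_of_norm_hasDerivWithin_le
      (f := fun s => u s - (s - t) • u1 t) (f' := fun s => u1 s - u1 t) (C := C * |r|)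
      (x := t) (y := t + r)
      (fun x _ => by
        have a := (hu x).sub (((hasDerivAt_id x).sub_const t).smul_const (u1 t))
        simp only [one_smul] at a
        exact a.hasDerivWithinAt)
      (fun x hx => by
        have hb : |x - t| ≤ |r| := by
          have := Set.abs_sub_left_of_mem_uIcc hx
          simpa using this
        have hb' := abs_le.1 (hb.trans hr)
        exact (hlip x ⟨by linarith, by linarith⟩).trans (by gcongr))
      Set.left_mem_uIcc Set.right_mem_uIcc
  simp only [add_sub_cancel_left, sub_self, zero_smul, sub_zero, Real.norm_eq_abs] at key
  rw [mul_assoc, abs_mul_abs_self, ← sq] at key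
  convert key using 2
  abel

theorem aux_zero0 (c : E) : ∫ θ in (-1 : ℝ)..1, (|θ| - 1 / 2) • c = 0 := by
  rw [intervalIntegral.integral_smul_const, aux_split (fun θ => θ - 1 / 2) (fun θ => -θ - 1 / 2) (by fun_prop) _
    (by fun_prop) (by fun_prop) (fun x hx => by simp only [abs_of_nonneg hx])
    (fun x hx => by simp only [abs_of_nonpos hx])]
  rw [integral_sub (Continuous.intervalIntegrable (by fun_prop) _ _)
    (Continuous.intervalIntegrable (by fun_prop) _ _),
    integral_sub (Continuous.intervalIntegrable (by fun_prop) _ _)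
    (Continuous.intervalIntegrable (by fun_prop) _ _)]
  have : (∫ θ in (-1 : ℝ)..0, -θ) = 1 / 2 := by rw [intervalIntegral.integral_neg]; norm_num
  rw [this]
  norm_num

theorem aux_zero1 (c : E) : ∫ θ in (-1 : ℝ)..1, ((|θ| - 1 / 2) * θ) • c = 0 := by
  rw [intervalIntegral.integral_smul_const]
  have : ∫ θ in (-1 : ℝ)..1, ((|θ| - 1 / 2) * θ) = 0 := by
    have h := intervalIntegral.integral_comp_neg (a := -1) (b := 1)
      (fun θ : ℝ => (|θ| - 1 / 2) * θ)
    simp only [abs_neg, mul_neg, intervalIntegral.integral_neg, neg_neg] at h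
    linarith
  rw [this, zero_smul]

theorem aux_main (v u u1 u2 : ℝ → E) (hv : ∀ s, HasDerivAt v (u s) s)
    (hu : ∀ s, HasDerivAt u (u1 s) s)
    (hu1 : ∀ s, HasDerivAt u1 (u2 s) s) (hc : Continuous u2) (t : ℝ) :
    (fun h : ℝ => (h / 2) • (v (t + h) - v (t - h))
      - h ^ 2 • ∫ θ in (-1 : ℝ)..1, (1 - |θ|) • u (t + θ * h)) =O[𝓝 (0 : ℝ)] fun h => h ^ 4 := by
  have hcu : Continuous u := continuous_iff_continuousAt.2 fun s => (hu s).continuousAt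
  obtain ⟨C, hC0, hC⟩ := aux_taylor u u1 u2 hu hu1 hc t
  apply IsBigO.of_bound (C * 2)
  filter_upwards [Metric.closedBall_mem_nhds (0 : ℝ) one_pos] with h hh
  have hh : |h| ≤ 1 := by simpa using hh
  have e : (h / 2) • (v (t + h) - v (t - h))
      - h ^ 2 • ∫ θ in (-1 : ℝ)..1, (1 - |θ|) • u (t + θ * h)
      = h ^ 2 • ∫ θ in (-1 : ℝ)..1, (|θ| - 1 / 2) • (u (t + θ * h) - u t - (θ * h) • u1 t) := by
    have e1 : ∫ θ in (-1 : ℝ)..1, (|θ| - 1 / 2) • (u (t + θ * h) - u t - (θ * h) • u1 t)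
        = (∫ θ in (-1 : ℝ)..1, (1 / 2 : ℝ) • u (t + θ * h))
          - (∫ θ in (-1 : ℝ)..1, (1 - |θ|) • u (t + θ * h))
          - (∫ θ in (-1 : ℝ)..1, (|θ| - 1 / 2) • u t)
          - ∫ θ in (-1 : ℝ)..1, ((|θ| - 1 / 2) * θ) • (h • u1 t) := by
      rw [← integral_sub, ← integral_sub, ← integral_sub]
      · congr 1
        ext θ
        module
      all_goals exact Continuous.intervalIntegrable (by fun_prop) _ _
    rw [e1, aux_zero0, aux_zero1, integral_smul, ← aux_first v u hv hcu t h]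
    module
  rw [e, norm_smul]
  have b := norm_integral_le_of_norm_le_const (a := (-1 : ℝ)) (b := 1) (C := C * h ^ 2)
    (f := fun θ => (|θ| - 1 / 2) • (u (t + θ * h) - u t - (θ * h) • u1 t)) (by
      intro θ hθ
      rw [Set.uIoc_of_le (by norm_num)] at hθ
      have h1 : |θ| ≤ 1 := abs_le.2 ⟨hθ.1.le, hθ.2⟩
      have h2 : ‖|θ| - 1 / 2‖ ≤ 1 := by
        rw [Real.norm_eq_abs, abs_le]
        constructor <;> linarith [abs_nonneg θ]
      have h3 : |θ * h| ≤ 1 := by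
        rw [abs_mul]; exact mul_le_one₀ h1 (abs_nonneg _) hh
      have h4 : (θ * h) ^ 2 ≤ h ^ 2 := by
        rw [mul_pow]
        have : θ ^ 2 ≤ 1 := (sq_le_one_iff_abs_le_one θ).2 h1
        nlinarith [sq_nonneg h]
      rw [norm_smul]
      calc _ ≤ 1 * (C * (θ * h) ^ 2) := by
            gcongr
            exact hC _ h3
        _ ≤ C * h ^ 2 := by rw [one_mul]; gcongr)
  have e2 : |(1 : ℝ) - -1| = 2 := by norm_num
  rw [e2] at b
  rw [Real.norm_of_nonneg (by positivity), Real.norm_of_nonneg (by positivity)]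
  calc _ ≤ h ^ 2 * (C * h ^ 2 * 2) := by gcongr
    _ = _ := by ring

end helpers

/-- for `z ∈ C⁴` with `z'' + D z' + A z = R`, as `Δt → 0`,
`z(t+Δt) − 2z(t) + z(t−Δt) + (Δt/2)D(z(t+Δt) − z(t−Δt))
 − Δt² ∫_{−1}^{1}(1−|θ|)(R(t+θΔt) − A z(t+θΔt)) dθ = O(Δt⁴)`. -/
theorem stmt_12 (N : ℕ) (A D : Matrix (Fin N) (Fin N) ℝ)
    (R z : ℝ → (Fin N → ℝ)) (hR : Continuous R) (hz : ContDiff ℝ 4 z)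
    (hode : ∀ s : ℝ, deriv (deriv z) s + D.mulVec (deriv z s) + A.mulVec (z s) = R s)
    (t : ℝ) :
    (fun Δt : ℝ =>
        z (t + Δt) - (2 : ℝ) • z t + z (t - Δt)
          + (Δt / 2) • D.mulVec (z (t + Δt) - z (t - Δt))
          - Δt ^ 2 • ∫ θ in (-1 : ℝ)..1,
              (1 - |θ|) • (R (t + θ * Δt) - A.mulVec (z (t + θ * Δt))))
      =O[𝓝 (0 : ℝ)] fun Δt => Δt ^ 4 := by
  have hd : ∀ (n : ℕ) (f : ℝ → Fin N → ℝ), ContDiff ℝ (n + 1) f →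
      ContDiff ℝ n (deriv f) ∧ ∀ s, HasDerivAt f (deriv f s) s := by
    intro n f hf
    have := contDiff_succ_iff_deriv.1 hf
    exact ⟨this.2.2, fun s => (this.1 s).hasDerivAt⟩
  obtain ⟨c1, d0⟩ := hd 3 z (by exact_mod_cast hz)
  obtain ⟨c2, d1⟩ := hd 2 (deriv z) (by exact_mod_cast c1)
  obtain ⟨c3, d2⟩ := hd 1 (deriv (deriv z)) (by exact_mod_cast c2)
  let L : (Fin N → ℝ) →L[ℝ] (Fin N → ℝ) := LinearMap.toContinuousLinearMap D.mulVecLin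
  have hL : ∀ x, D.mulVec x = L x := fun x => rfl
  have k1 : Continuous (deriv z) := c1.continuous
  have k2 : Continuous (deriv (deriv z)) := c2.continuous
  have k3 : Continuous (deriv (deriv (deriv z))) := c3.continuous
  have main := aux_main (fun s => L (z s)) (fun s => L (deriv z s))
    (fun s => L (deriv (deriv z) s)) (fun s => L (deriv (deriv (deriv z)) s))
    (fun s => L.hasFDerivAt.comp_hasDerivAt s (d0 s))
    (fun s => L.hasFDerivAt.comp_hasDerivAt s (d1 s))
    (fun s => L.hasFDerivAt.comp_hasDerivAt s (d2 s)) (by fun_prop) t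
  refine main.congr_left fun h => ?_
  have e : ∀ s, R s - A.mulVec (z s) = deriv (deriv z) s + L (deriv z s) := by
    intro s
    rw [← hode s, ← hL]
    abel
  simp only [e, smul_add]
  rw [integral_add (Continuous.intervalIntegrable (by fun_prop) _ _)
    (Continuous.intervalIntegrable (by fun_prop) _ _), smul_add,
    aux_second z _ _ d0 d1 k2 t h, hL, map_sub]
  abel
end

section
/- Let A, D be real N×N matrices, R : ℝ → ℝ^N continuous, and let z : ℝ → ℝ^N be three times continuously differentiable with z''(s) + D z'(s) + A z(s) = R(s) for all s. Fix t ∈ ℝ. For Δt > 0 small enough that I + (Δt/2) D is invertible, define z'_n(Δt) := (1/2) [ (z(t) − z(t − Δt))/Δt + (I + (Δt/2) D)^{−1} { (I − (Δt/2) D)(z(t) − z(t − Δt))/Δt + Δt R(t) − Δt A z(t) } ]. Then z'_n(Δt) − z'(t) = O(Δt²) as Δt → 0⁺. -/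
open Matrix Topology Asymptotics

open Filter in
theorem aux_taylor_s13 {E : Type*} [NormedAddCommGroup E] [NormedSpace ℝ E] (z : ℝ → E)
    (hz : ContDiff ℝ 3 z) (t : ℝ) :
    (fun h : ℝ => h⁻¹ • (z t - z (t - h)) - deriv z t + (h / 2) • deriv (deriv z) t)
      =O[𝓝[>] (0 : ℝ)] fun h => h ^ 2 := by
  have h1 := taylor_isLittleO_univ (f := z) (x₀ := t) (n := 3) (by exact_mod_cast hz)
  have htend : Tendsto (fun h : ℝ => t - h) (𝓝[>] 0) (𝓝 t) := by
    have : Tendsto (fun h : ℝ => t - h) (𝓝 0) (𝓝 (t - 0)) :=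
      (continuous_const.sub continuous_id).tendsto 0
    rw [sub_zero] at this
    exact this.mono_left nhdsWithin_le_nhds
  have h2 := (h1.comp_tendsto htend).isBigO
  have h3 : (fun h : ℝ => h ^ 3 • ((1 / 6 : ℝ) • iteratedDeriv 3 z t))
      =O[𝓝[>] (0 : ℝ)] fun h => h ^ 3 := by
    have := (isBigO_refl (fun h : ℝ => h ^ 3) (𝓝[>] (0 : ℝ))).smul
      (isBigO_const_const ((1 / 6 : ℝ) • iteratedDeriv 3 z t) (one_ne_zero (α := ℝ)) (𝓝[>] (0 : ℝ)))
    simpa using this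
  have h4 : (fun h : ℝ => z (t - h) - z t + h • deriv z t - (h ^ 2 / 2) • deriv (deriv z) t)
      =O[𝓝[>] (0 : ℝ)] fun h => h ^ 3 := by
    have h2' : ((fun x ↦ z x - taylorWithinEval z 3 Set.univ t x) ∘ fun h : ℝ => t - h)
      =O[𝓝[>] (0 : ℝ)] fun h => h ^ 3 := by
      refine h2.trans (IsBigO.of_bound 1 (Eventually.of_forall fun h => ?_))
      simp
    refine (h2'.sub h3).congr_left fun h => ?_
    simp only [Function.comp, taylor_within_apply, Finset.sum_range_succ, Finset.sum_range_zero,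
      iteratedDerivWithin_univ, iteratedDeriv_succ, iteratedDeriv_zero, Nat.factorial]
    push_cast
    module
  have h5 := (isBigO_refl (fun h : ℝ => -h⁻¹) (𝓝[>] (0 : ℝ))).smul h4
  have h6 : (fun h : ℝ => - h ^ 2) =O[𝓝[>] (0 : ℝ)] fun h => h ^ 2 :=
    (isBigO_refl (fun h : ℝ => h ^ 2) (𝓝[>] (0 : ℝ))).neg_left
  refine (h5.congr' (g₂ := fun h : ℝ => - h ^ 2) ?_ ?_).trans h6
  · filter_upwards [self_mem_nhdsWithin] with h hh
    have hh : h ≠ 0 := ne_of_gt hh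
    match_scalars <;> field_simp
  · filter_upwards [self_mem_nhdsWithin] with h hh
    have hh : h ≠ 0 := ne_of_gt hh
    simp only [smul_eq_mul]
    field_simp

/-- the starting-value approximation
`z'_n(Δt) = ½[(z(t) − z(t−Δt))/Δt + (I + (Δt/2)D)⁻¹{(I − (Δt/2)D)(z(t) − z(t−Δt))/Δt
  + Δt R(t) − Δt A z(t)}]`
satisfies `z'_n(Δt) − z'(t) = O(Δt²)` as `Δt → 0⁺`, for `z ∈ C³` solving
`z'' + D z' + A z = R`. -/
theorem stmt_13 (N : ℕ) (A D : Matrix (Fin N) (Fin N) ℝ)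
    (R z : ℝ → (Fin N → ℝ)) (hR : Continuous R) (hz : ContDiff ℝ 3 z)
    (hode : ∀ s : ℝ, deriv (deriv z) s + D.mulVec (deriv z s) + A.mulVec (z s) = R s)
    (t : ℝ) :
    (fun Δt : ℝ =>
        (1 / 2 : ℝ) •
          (Δt⁻¹ • (z t - z (t - Δt))
            + (((1 : Matrix (Fin N) (Fin N) ℝ) + (Δt / 2) • D)⁻¹).mulVec
                ((((1 : Matrix (Fin N) (Fin N) ℝ) - (Δt / 2) • D)).mulVec
                    (Δt⁻¹ • (z t - z (t - Δt)))
                  + Δt • R t - Δt • A.mulVec (z t)))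
          - deriv z t)
      =O[𝓝[>] (0 : ℝ)] fun Δt => Δt ^ 2 := by
  have hr := aux_taylor_s13 z hz t
  have hMc : Continuous (fun h : ℝ => (1 : Matrix (Fin N) (Fin N) ℝ) + (h / 2) • D) := by
    fun_prop
  have hdet : ContinuousAt (fun h : ℝ => ((1 : Matrix (Fin N) (Fin N) ℝ) + (h / 2) • D).det) 0 :=
    hMc.matrix_det.continuousAt
  have hne : ∀ᶠ h : ℝ in 𝓝[>] 0, ((1 : Matrix (Fin N) (Fin N) ℝ) + (h / 2) • D).det ≠ 0 :=
    (hdet.eventually_ne (by simp)).filter_mono nhdsWithin_le_nhds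
  have hinv : ContinuousAt (fun h : ℝ => ((1 : Matrix (Fin N) (Fin N) ℝ) + (h / 2) • D)⁻¹) 0 := by
    simp only [Matrix.inv_def, Ring.inverse_eq_inv']
    exact (hdet.inv₀ (by simp)).smul hMc.matrix_adjugate.continuousAt
  have key : (fun h : ℝ => (((1 : Matrix (Fin N) (Fin N) ℝ) + (h / 2) • D)⁻¹).mulVec
      (h⁻¹ • (z t - z (t - h)) - deriv z t + (h / 2) • deriv (deriv z) t))
      =O[𝓝[>] (0 : ℝ)] fun h => h ^ 2 := by
    rw [isBigO_pi] at hr ⊢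
    intro i
    simp only [Matrix.mulVec, dotProduct]
    refine IsBigO.fun_sum (A := fun j (h : ℝ) => (((1 : Matrix (Fin N) (Fin N) ℝ) + (h / 2) • D)⁻¹) i j * (h⁻¹ • (z t - z (t - h)) - deriv z t + (h / 2) • deriv (deriv z) t) j) fun j _ => ?_
    have hb : (fun h : ℝ => (((1 : Matrix (Fin N) (Fin N) ℝ) + (h / 2) • D)⁻¹) i j)
        =O[𝓝[>] (0 : ℝ)] fun _ => (1 : ℝ) := by
      have hc : ContinuousAt
          (fun h : ℝ => (((1 : Matrix (Fin N) (Fin N) ℝ) + (h / 2) • D)⁻¹) i j) 0 :=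
        continuousAt_pi.1 (continuousAt_pi.1 hinv i) j
      exact (hc.tendsto.mono_left nhdsWithin_le_nhds).isBigO_one ℝ
    simpa using hb.mul (hr j)
  refine key.congr' ?_ (Filter.EventuallyEq.refl _ _)
  filter_upwards [hne] with h hh
  have hu : IsUnit ((1 : Matrix (Fin N) (Fin N) ℝ) + (h / 2) • D).det := isUnit_iff_ne_zero.mpr hh
  have hcancel : ∀ v : Fin N → ℝ, v = (((1 : Matrix (Fin N) (Fin N) ℝ) + (h / 2) • D)⁻¹).mulVec
      (((1 : Matrix (Fin N) (Fin N) ℝ) + (h / 2) • D).mulVec v) := fun v => by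
    rw [Matrix.mulVec_mulVec, Matrix.nonsing_inv_mul _ hu, Matrix.one_mulVec]
  rw [← hode t]
  generalize h⁻¹ • (z t - z (t - h)) = w
  generalize deriv (deriv z) t = z2
  generalize deriv z t = z1
  generalize z t = z0
  conv_rhs => rw [sub_eq_add_neg]
  conv_rhs =>
    enter [1, 2, 1]
    rw [hcancel w]
  conv_rhs =>
    enter [2, 1]
    rw [hcancel z1]
  rw [← Matrix.mulVec_add, ← Matrix.mulVec_smul, ← Matrix.mulVec_neg, ← Matrix.mulVec_add]
  congr 1
  simp only [Matrix.add_mulVec, Matrix.sub_mulVec, Matrix.one_mulVec, Matrix.smul_mulVec]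
  module
end

section
/- Let A be a real symmetric N×N matrix, let D be a real symmetric positive semidefinite N×N matrix, and let Δt > 0. Let (z_n) be a sequence in ℝ^N satisfying z_{n+1} − 2 z_n + z_{n−1} + (Δt/2) D ( z_{n+1} − z_{n−1} ) = −Δt² A z_n for all n ≥ 1. Then the discrete energy E^{n+1/2} := (1/2)[ ⟨(I − (Δt²/4) A) (z_{n+1} − z_n)/Δt, (z_{n+1} − z_n)/Δt⟩ + ⟨A (z_{n+1} + z_n)/2, (z_{n+1} + z_n)/2⟩ ] is non-increasing: E^{n+1/2} ≤ E^{n−1/2} for all n ≥ 1. -/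
open Matrix

lemma energy_aux {N : ℕ} (A : Matrix (Fin N) (Fin N) ℝ) (hA : A.IsSymm) (t : ℝ) (ht : 0 < t)
    (a b : Fin N → ℝ) :
    (((1 : Matrix (Fin N) (Fin N) ℝ) - (t ^ 2 / 4) • A).mulVec
            (t⁻¹ • (a - b)) ⬝ᵥ (t⁻¹ • (a - b)))
          + (A.mulVec ((1 / 2 : ℝ) • (a + b)) ⬝ᵥ ((1 / 2 : ℝ) • (a + b)))
    = (t⁻¹) ^ 2 * ((a - b) ⬝ᵥ (a - b)) + A.mulVec b ⬝ᵥ a := by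
  have hs : A.mulVec a ⬝ᵥ b = A.mulVec b ⬝ᵥ a := by
    rw [dotProduct_comm, dotProduct_mulVec, ← mulVec_transpose, hA.eq]
  simp only [sub_mulVec, smul_mulVec, mulVec_smul, mulVec_add, mulVec_sub, one_mulVec,
    dotProduct_smul, smul_dotProduct, add_dotProduct, dotProduct_add, sub_dotProduct,
    dotProduct_sub, smul_eq_mul, hs]
  field_simp
  ring

/-- for `A` symmetric, `D` symmetric positive semidefinite and the damped
leap-frog/Crank–Nicolson recurrence
`z_{n+1} − 2z_n + z_{n−1} + (Δt/2)D(z_{n+1} − z_{n−1}) = −Δt² A z_n`,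
the discrete energy is non-increasing: `E^{n+1/2} ≤ E^{n−1/2}` for all `n ≥ 1`. -/
theorem stmt_14 (N : ℕ) (A D : Matrix (Fin N) (Fin N) ℝ) (hA : A.IsSymm)
    (hD : D.PosSemidef) (Δt : ℝ) (hΔt : 0 < Δt) (z : ℕ → (Fin N → ℝ))
    (hrec : ∀ n : ℕ, 1 ≤ n →
      z (n + 1) - (2 : ℝ) • z n + z (n - 1) + (Δt / 2) • D.mulVec (z (n + 1) - z (n - 1))
        = -(Δt ^ 2 • A.mulVec (z n))) :
    ∀ n : ℕ, 1 ≤ n →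
      (1 / 2 : ℝ) *
        ((((1 : Matrix (Fin N) (Fin N) ℝ) - (Δt ^ 2 / 4) • A).mulVec
            (Δt⁻¹ • (z (n + 1) - z n)) ⬝ᵥ (Δt⁻¹ • (z (n + 1) - z n)))
          + (A.mulVec ((1 / 2 : ℝ) • (z (n + 1) + z n)) ⬝ᵥ ((1 / 2 : ℝ) • (z (n + 1) + z n))))
      ≤ (1 / 2 : ℝ) *
        ((((1 : Matrix (Fin N) (Fin N) ℝ) - (Δt ^ 2 / 4) • A).mulVec
            (Δt⁻¹ • (z n - z (n - 1))) ⬝ᵥ (Δt⁻¹ • (z n - z (n - 1))))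
          + (A.mulVec ((1 / 2 : ℝ) • (z n + z (n - 1))) ⬝ᵥ ((1 / 2 : ℝ) • (z n + z (n - 1))))) := by
  intro n hn
  have h := hrec n hn
  rw [energy_aux A hA Δt hΔt, energy_aux A hA Δt hΔt]
  have hs : A.mulVec (z (n - 1)) ⬝ᵥ z n = A.mulVec (z n) ⬝ᵥ z (n - 1) := by
    rw [dotProduct_comm, dotProduct_mulVec, ← mulVec_transpose, hA.eq]
  rw [hs]
  generalize z (n + 1) = a at *
  generalize z (n - 1) = c at *
  generalize z n = b at *
  have hp : 0 ≤ (a - c) ⬝ᵥ D.mulVec (a - c) := by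
    simpa using hD.dotProduct_mulVec_nonneg (a - c)
  have h2 := congrArg (fun v => (a - c) ⬝ᵥ v) h
  simp only [dotProduct_add, dotProduct_neg, dotProduct_smul, smul_eq_mul] at h2
  generalize (a - c) ⬝ᵥ D.mulVec (a - c) = p at *
  rw [dotProduct_comm (a - c) (A.mulVec b)] at h2
  simp only [sub_dotProduct, dotProduct_sub, dotProduct_smul, smul_eq_mul,
    dotProduct_comm b a, dotProduct_comm c a, dotProduct_comm c b] at h2 ⊢
  have hq : 0 ≤ Δt * p := by positivity
  rw [← sub_nonneg]
  refine le_of_le_of_eq (b := (Δt⁻¹) ^ 2 * (Δt * p) / 4) (by positivity) ?_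
  field_simp
  linarith
end
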